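/- Let Λ be a row-finite locally convex k-graph, v ∈ Λ⁰ a vertex and x an end of Λ, and suppose there is an infinite set of mutually orthogonal paths each with range v and with source lying on x. Then every k-graph trace g on Λ satisfies g(x(0)) = 0; in particular, Λ admits no faithful k-graph trace. -/

import Mathlib

open scoped BigOperators ENNReal NNReal

/-- A `k`-graph: a countable small category `Λ` together with a degree functor
`d : Λ → ℕ^k` satisfying the factorisation property.  Objects are identified with
the identity morphisms, i.e. the paths of degree `0`. -/
structure KGraph (k : ℕ) where
  /-- The morphisms ("paths") of the category. -/
  Path : Type
  countable : Countable Path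
  /-- The degree functor. -/
  d : Path → Fin k → ℕ
  /-- The range (codomain) of a path, as an identity morphism. -/
  r : Path → Path
  /-- The source (domain) of a path, as an identity morphism. -/
  s : Path → Path
  /-- Composition `μν` of paths with `s μ = r ν`. -/
  comp : (μ ν : Path) → s μ = r ν → Path
  d_r : ∀ lam : Path, d (r lam) = 0
  d_s : ∀ lam : Path, d (s lam) = 0
  /-- Paths of degree zero are identity morphisms, identified with their range. -/
  vertex_r : ∀ v : Path, d v = 0 → r v = v
  vertex_s : ∀ v : Path, d v = 0 → s v = v
  r_comp : ∀ (μ ν : Path) (h : s μ = r ν), r (comp μ ν h) = r μ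
  s_comp : ∀ (μ ν : Path) (h : s μ = r ν), s (comp μ ν h) = s ν
  d_comp : ∀ (μ ν : Path) (h : s μ = r ν), d (comp μ ν h) = d μ + d ν
  comp_assoc : ∀ (lam μ ν : Path) (h₁ : s lam = r μ) (h₂ : s μ = r ν)
      (h₃ : s (comp lam μ h₁) = r ν) (h₄ : s lam = r (comp μ ν h₂)),
      comp (comp lam μ h₁) ν h₃ = comp lam (comp μ ν h₂) h₄
  id_comp : ∀ (lam : Path) (h : s (r lam) = r lam), comp (r lam) lam h = lam
  comp_id : ∀ (lam : Path) (h : s lam = r (s lam)), comp lam (s lam) h = lam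
  /-- The factorisation property. -/
  factor : ∀ (lam : Path) (m n : Fin k → ℕ), d lam = m + n →
      ∃! p : Path × Path, ∃ h : s p.1 = r p.2,
        d p.1 = m ∧ d p.2 = n ∧ comp p.1 p.2 h = lam

namespace KGraph

variable {k : ℕ} (Λ : KGraph k)

/-- A vertex is a path of degree `0`. -/
def IsVertex (v : Λ.Path) : Prop := Λ.d v = 0

/-- The set `vΛⁿ` of paths of degree `n` with range `v`. -/
def paths (v : Λ.Path) (n : Fin k → ℕ) : Set Λ.Path :=
  {lam | Λ.d lam = n ∧ Λ.r lam = v}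

/-- The set `Λⁿv` of paths of degree `n` with source `v`. -/
def pathsTo (v : Λ.Path) (n : Fin k → ℕ) : Set Λ.Path :=
  {lam | Λ.d lam = n ∧ Λ.s lam = v}

/-- The set `Λ^{≤ n}`. -/
def lePaths (n : Fin k → ℕ) : Set Λ.Path :=
  {lam | Λ.d lam ≤ n ∧
    ∀ (μ : Λ.Path) (_ : Λ.s lam = Λ.r μ), Λ.d lam + Λ.d μ ≤ n → μ = Λ.s lam}

/-- The set `vΛ^{≤ n}`. -/
def vLePaths (v : Λ.Path) (n : Fin k → ℕ) : Set Λ.Path :=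
  {lam | lam ∈ Λ.lePaths n ∧ Λ.r lam = v}

/-- `Λ` is row-finite if each `vΛⁿ` is finite. -/
def RowFinite : Prop := ∀ (v : Λ.Path) (n : Fin k → ℕ), (Λ.paths v n).Finite

/-- `Λ` is locally finite if it is row-finite and each `Λⁿv` is finite. -/
def LocallyFinite : Prop :=
  Λ.RowFinite ∧ ∀ (v : Λ.Path) (n : Fin k → ℕ), (Λ.pathsTo v n).Finite

/-- `Λ` has no sinks if each `Λⁿv` is nonempty. -/
def NoSinks : Prop :=
  ∀ (v : Λ.Path), Λ.IsVertex v → ∀ n : Fin k → ℕ, (Λ.pathsTo v n).Nonempty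

/-- `Λ` has no sources if each `vΛⁿ` is nonempty. -/
def NoSources : Prop :=
  ∀ (v : Λ.Path), Λ.IsVertex v → ∀ n : Fin k → ℕ, (Λ.paths v n).Nonempty

/-- `Λ` is locally convex. -/
def LocallyConvex : Prop :=
  ∀ (i j : Fin k), i ≠ j → ∀ e : Λ.Path, Λ.d e = Pi.single i 1 →
    Λ.paths (Λ.s e) (Pi.single j 1) = ∅ → Λ.paths (Λ.r e) (Pi.single j 1) = ∅

/-- A `k`-graph trace on `Λ`: a function `g : Λ⁰ → [0,∞)` (extended arbitrarily to
all paths) with `g v = Σ_{λ ∈ vΛ^{≤n}} g (s λ)` for every vertex `v` and `n ∈ ℕ^k`. -/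
def IsGraphTrace (g : Λ.Path → ℝ) : Prop :=
  (∀ v : Λ.Path, Λ.IsVertex v → 0 ≤ g v) ∧
  ∀ (v : Λ.Path), Λ.IsVertex v → ∀ (n : Fin k → ℕ) (F : Finset Λ.Path),
    ↑F = Λ.vLePaths v n → g v = ∑ lam ∈ F, g (Λ.s lam)

/-- Two paths are orthogonal if they have no common extension. -/
def Orthogonal (μ ν : Λ.Path) : Prop :=
  ¬ ∃ (α β : Λ.Path) (h₁ : Λ.s μ = Λ.r α) (h₂ : Λ.s ν = Λ.r β),
      Λ.comp μ α h₁ = Λ.comp ν β h₂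

end KGraph

/-- A boundary path of degree `m ∈ (ℕ ∪ {∞})^k` in a `k`-graph `Λ`. -/
structure KGraph.BoundaryPath {k : ℕ} (Λ : KGraph k) where
  /-- The degree of the boundary path. -/
  deg : Fin k → ℕ∞
  /-- The segment `x(p,q)` for `p ≤ q ≤ deg`. -/
  seg : (Fin k → ℕ) → (Fin k → ℕ) → Λ.Path
  seg_d : ∀ p q : Fin k → ℕ, p ≤ q → (∀ i, (q i : ℕ∞) ≤ deg i) →
    Λ.d (seg p q) = q - p
  seg_r : ∀ p q : Fin k → ℕ, p ≤ q → (∀ i, (q i : ℕ∞) ≤ deg i) →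
    Λ.r (seg p q) = seg p p
  seg_s : ∀ p q : Fin k → ℕ, p ≤ q → (∀ i, (q i : ℕ∞) ≤ deg i) →
    Λ.s (seg p q) = seg q q
  seg_comp : ∀ p q t : Fin k → ℕ, p ≤ q → q ≤ t → (∀ i, (t i : ℕ∞) ≤ deg i) →
    ∀ h : Λ.s (seg p q) = Λ.r (seg q t), Λ.comp (seg p q) (seg q t) h = seg p t
  boundary : ∀ (i : Fin k) (n : Fin k → ℕ), (∀ j, (n j : ℕ∞) ≤ deg j) →
    (n i : ℕ∞) = deg i → Λ.paths (seg n n) (Pi.single i 1) = ∅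

namespace KGraph

variable {k : ℕ} (Λ : KGraph k)

/-- An end of `Λ`: a boundary path `x` with `r(x)Λⁿ = {x(0,n)}` for all `n ≤ d(x)`. -/
def IsEnd (x : Λ.BoundaryPath) : Prop :=
  ∀ n : Fin k → ℕ, (∀ i, (n i : ℕ∞) ≤ x.deg i) →
    Λ.paths (x.seg 0 0) n = {x.seg 0 n}

/-- A vertex `v` lies on the boundary path `x` if `v = x(n)` for some `n ≤ d(x)`. -/
def LiesOn (v : Λ.Path) (x : Λ.BoundaryPath) : Prop :=
  ∃ n : Fin k → ℕ, (∀ i, (n i : ℕ∞) ≤ x.deg i) ∧ v = x.seg n n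

/-- Two ends are equivalent if they pass through a common vertex. -/
def EndEquiv (x y : Λ.BoundaryPath) : Prop :=
  ∃ (n m : Fin k → ℕ), (∀ i, (n i : ℕ∞) ≤ x.deg i) ∧ (∀ i, (m i : ℕ∞) ≤ y.deg i) ∧
    x.seg n n = y.seg m m

end KGraph

/-- A Cuntz–Krieger `Λ`-family in a `C*`-algebra `A`. -/
structure CKFamily {k : ℕ} (Λ : KGraph k) (A : Type*) [NormedRing A] [StarRing A] where
  /-- The partial isometries `s_λ`. -/
  S : Λ.Path → A
  partial_isom : ∀ lam : Λ.Path, S lam * star (S lam) * S lam = S lam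
  vertex_star : ∀ v : Λ.Path, Λ.IsVertex v → star (S v) = S v
  vertex_idem : ∀ v : Λ.Path, Λ.IsVertex v → S v * S v = S v
  vertex_orth : ∀ v w : Λ.Path, Λ.IsVertex v → Λ.IsVertex w → v ≠ w → S v * S w = 0
  comp_mul : ∀ (μ ν : Λ.Path) (h : Λ.s μ = Λ.r ν), S μ * S ν = S (Λ.comp μ ν h)
  star_mul_self : ∀ lam : Λ.Path, star (S lam) * S lam = S (Λ.s lam)
  cuntz_krieger : ∀ (v : Λ.Path), Λ.IsVertex v → ∀ (n : Fin k → ℕ) (F : Finset Λ.Path),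
    ↑F = Λ.vLePaths v n → S v = ∑ lam ∈ F, S lam * star (S lam)

/-- A trace on a `C*`-algebra `A`: a map `τ : A⁺ → [0,∞]` (extended arbitrarily to `A`)
which is additive and positively homogeneous on the positive cone and tracial. -/
structure CstarTrace (A : Type*) [NormedRing A] [StarRing A] [PartialOrder A]
    [Module ℝ A] where
  /-- The underlying map. -/
  τ : A → ℝ≥0∞
  map_add : ∀ a b : A, 0 ≤ a → 0 ≤ b → τ (a + b) = τ a + τ b
  map_smul : ∀ (c : ℝ) (a : A), 0 ≤ c → 0 ≤ a → τ (c • a) = ENNReal.ofReal c * τ a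
  tracial : ∀ a : A, τ (star a * a) = τ (a * star a)

namespace KGraph

variable {k : ℕ} {Λ : KGraph k}

theorem comp_left_cancel {μ ν ν' : Λ.Path} (h : Λ.s μ = Λ.r ν) (h' : Λ.s μ = Λ.r ν')
    (heq : Λ.comp μ ν h = Λ.comp μ ν' h') : ν = ν' := by
  have hd : Λ.d ν' = Λ.d ν := by
    have := congrArg Λ.d heq
    rw [Λ.d_comp, Λ.d_comp] at this
    exact (add_left_cancel this).symm
  have := (Λ.factor (Λ.comp μ ν h) (Λ.d μ) (Λ.d ν) (Λ.d_comp μ ν h)).unique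
    (y₁ := (μ, ν)) (y₂ := (μ, ν')) ⟨h, rfl, rfl, rfl⟩ ⟨h', rfl, hd, heq.symm⟩
  exact congrArg Prod.snd this

theorem RowFinite.finite_vLePaths (hrf : Λ.RowFinite) (v : Λ.Path) (n : Fin k → ℕ) :
    (Λ.vLePaths v n).Finite := by
  refine ((Set.finite_Iic n).biUnion fun m _ => hrf v m).subset ?_
  rintro lam ⟨⟨hle, -⟩, hr⟩
  exact Set.mem_biUnion (Set.mem_Iic.2 hle) ⟨rfl, hr⟩

theorem comp_mem_vLePaths_iff {μ ν : Λ.Path} (h : Λ.s μ = Λ.r ν) {n : Fin k → ℕ}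
    (hμ : Λ.d μ ≤ n) :
    Λ.comp μ ν h ∈ Λ.vLePaths (Λ.r μ) n ↔ ν ∈ Λ.vLePaths (Λ.s μ) (n - Λ.d μ) := by
  simp only [vLePaths, lePaths, Set.mem_ofPred_eq, Λ.d_comp, Λ.s_comp, Λ.r_comp, ← h, and_true,
    le_tsub_iff_left hμ, add_assoc]

/-- Mutually orthogonal paths with a common range `v` have total trace at most `g v`. -/
theorem IsGraphTrace.sum_source_le (hrf : Λ.RowFinite) {g : Λ.Path → ℝ}
    (hg : Λ.IsGraphTrace g) {v : Λ.Path} (hv : Λ.IsVertex v) (F : Finset Λ.Path)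
    (hr : ∀ μ ∈ F, Λ.r μ = v) (horth : ∀ μ ∈ F, ∀ ν ∈ F, μ ≠ ν → Λ.Orthogonal μ ν) :
    ∑ μ ∈ F, g (Λ.s μ) ≤ g v := by
  classical
  set n : Fin k → ℕ := F.sup Λ.d
  have hn : ∀ μ ∈ F, Λ.d μ ≤ n := fun μ hμ => Finset.le_sup hμ
  set G := (hrf.finite_vLePaths v n).toFinset
  have hG : ∀ lam, lam ∈ G ↔ lam ∈ Λ.vLePaths v n := fun lam => Set.Finite.mem_toFinset _
  let ext (μ : Λ.Path) : Finset Λ.Path :=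
    G.filter fun lam => ∃ (ν : Λ.Path) (h : Λ.s μ = Λ.r ν), Λ.comp μ ν h = lam
  have hext : ∀ μ ∈ F, g (Λ.s μ) = ∑ lam ∈ ext μ, g (Λ.s lam) := by
    intro μ hμ
    have hfin := hrf.finite_vLePaths (Λ.s μ) (n - Λ.d μ)
    rw [hg.2 (Λ.s μ) (Λ.d_s μ) (n - Λ.d μ) hfin.toFinset hfin.coe_toFinset]
    have hsr : ∀ ν ∈ hfin.toFinset, Λ.s μ = Λ.r ν := fun ν hν =>
      ((Set.Finite.mem_toFinset _).1 hν).2.symm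
    refine Finset.sum_bij (fun ν hν => Λ.comp μ ν (hsr ν hν)) ?_ ?_ ?_ ?_
    · intro ν hν
      refine Finset.mem_filter.2 ⟨(hG _).2 ?_, ν, hsr ν hν, rfl⟩
      rw [← hr μ hμ]
      exact (comp_mem_vLePaths_iff (hsr ν hν) (hn μ hμ)).2 ((Set.Finite.mem_toFinset _).1 hν)
    · intro ν hν ν' hν' heq
      exact comp_left_cancel _ _ heq
    · intro lam hlam
      obtain ⟨hlG, ν, h, rfl⟩ := Finset.mem_filter.1 hlam
      rw [hG, ← hr μ hμ, comp_mem_vLePaths_iff h (hn μ hμ)] at hlG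
      exact ⟨ν, (Set.Finite.mem_toFinset _).2 hlG, rfl⟩
    · intro ν hν
      rw [Λ.s_comp]
  have hdisj : (F : Set Λ.Path).PairwiseDisjoint ext := by
    intro μ hμ ν hν hne
    refine Finset.disjoint_left.2 fun lam hlam hlam' => ?_
    obtain ⟨-, α, h₁, hα⟩ := Finset.mem_filter.1 hlam
    obtain ⟨-, β, h₂, hβ⟩ := Finset.mem_filter.1 hlam'
    exact horth μ hμ ν hν hne ⟨α, β, h₁, h₂, hα.trans hβ.symm⟩
  rw [Finset.sum_congr rfl hext, ← Finset.sum_biUnion hdisj,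
    hg.2 v hv n G (Set.Finite.coe_toFinset _)]
  exact Finset.sum_le_sum_of_subset_of_nonneg
    (Finset.biUnion_subset.2 fun μ _ => Finset.filter_subset _ _)
    fun lam _ _ => hg.1 _ (Λ.d_s lam)

theorem BoundaryPath.isVertex_seg_self (x : Λ.BoundaryPath) {n : Fin k → ℕ}
    (hn : ∀ i, (n i : ℕ∞) ≤ x.deg i) : Λ.IsVertex (x.seg n n) :=
  (x.seg_d n n le_rfl hn).trans (tsub_self n)

theorem IsEnd.vLePaths_eq {x : Λ.BoundaryPath} (hx : Λ.IsEnd x) {n : Fin k → ℕ}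
    (hn : ∀ i, (n i : ℕ∞) ≤ x.deg i) : Λ.vLePaths (x.seg 0 0) n = {x.seg 0 n} := by
  have hd : ∀ m ≤ n, ∀ i, (m i : ℕ∞) ≤ x.deg i := fun m hm i =>
    (Nat.cast_le.2 (hm i)).trans (hn i)
  have hdeg : Λ.d (x.seg 0 n) = n := by rw [x.seg_d 0 n zero_le hn, tsub_zero]
  ext lam
  rw [Set.mem_singleton_iff]
  constructor
  · rintro ⟨⟨hle, hmax⟩, hr⟩
    have hlam : lam = x.seg 0 (Λ.d lam) := by
      have : lam ∈ Λ.paths (x.seg 0 0) (Λ.d lam) := ⟨rfl, hr⟩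
      rwa [hx _ (hd _ hle)] at this
    have hs : Λ.s lam = x.seg (Λ.d lam) (Λ.d lam) :=
      (congrArg Λ.s hlam).trans (x.seg_s 0 _ zero_le (hd _ hle))
    have hdseg := x.seg_d (Λ.d lam) n hle hn
    have hv := hmax (x.seg (Λ.d lam) n) (hs.trans (x.seg_r _ _ hle hn).symm)
      (by rw [hdseg, add_tsub_cancel_of_le hle])
    rw [hv, Λ.d_s] at hdseg
    rwa [hle.antisymm (tsub_eq_zero_iff_le.1 hdseg.symm)] at hlam
  · rintro rfl
    refine ⟨⟨hdeg.le, fun μ hμ hle => ?_⟩, x.seg_r 0 n zero_le hn⟩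
    have hμ0 : Λ.d μ = 0 := by
      rw [hdeg] at hle
      exact le_antisymm (by simpa using hle) zero_le
    rw [hμ, Λ.vertex_r μ hμ0]

/-- A graph trace is constant along an end. -/
theorem IsGraphTrace.eq_of_liesOn {g : Λ.Path → ℝ} (hg : Λ.IsGraphTrace g)
    {x : Λ.BoundaryPath} (hx : Λ.IsEnd x) {u : Λ.Path} (hu : Λ.LiesOn u x) :
    g u = g (x.seg 0 0) := by
  obtain ⟨n, hn, rfl⟩ := hu
  rw [hg.2 (x.seg 0 0) (x.isVertex_seg_self fun i => by simp) n {x.seg 0 n}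
    (by rw [hx.vLePaths_eq hn, Finset.coe_singleton]), Finset.sum_singleton,
    x.seg_s 0 n zero_le hn]

end KGraph

/-- If there are infinitely many mutually orthogonal paths from an end `x` to a
vertex `v`, then every graph trace vanishes at `x(0)`, so there is no faithful
graph trace. -/
theorem no_faithful_trace_of_infinitely_many_orthogonal_paths_from_end
    {k : ℕ} (Λ : KGraph k) (hrf : Λ.RowFinite) (hlc : Λ.LocallyConvex)
    (v : Λ.Path) (hv : Λ.IsVertex v) (x : Λ.BoundaryPath) (hx : Λ.IsEnd x)
    (P : Set Λ.Path) (hinf : P.Infinite)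
    (hP : ∀ lam ∈ P, Λ.r lam = v ∧ Λ.LiesOn (Λ.s lam) x)
    (horth : ∀ μ ∈ P, ∀ ν ∈ P, μ ≠ ν → Λ.Orthogonal μ ν) :
    (∀ g : Λ.Path → ℝ, Λ.IsGraphTrace g → g (x.seg 0 0) = 0) ∧
    ¬ ∃ g : Λ.Path → ℝ, Λ.IsGraphTrace g ∧ ∀ u : Λ.Path, Λ.IsVertex u → g u ≠ 0 := by
  have h0 : Λ.IsVertex (x.seg 0 0) := x.isVertex_seg_self fun i => by simp
  have hzero : ∀ g : Λ.Path → ℝ, Λ.IsGraphTrace g → g (x.seg 0 0) = 0 := by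
    intro g hg
    refine le_antisymm (not_lt.1 fun hpos => ?_) (hg.1 _ h0)
    obtain ⟨N, hN⟩ := exists_lt_nsmul hpos (g v)
    obtain ⟨F, hFP, hcard⟩ := hinf.exists_subset_card_eq N
    have hle := hg.sum_source_le hrf hv F (fun μ hμ => (hP μ (hFP hμ)).1)
      fun μ hμ ν hν => horth μ (hFP hμ) ν (hFP hν)
    rw [Finset.sum_congr rfl fun μ hμ => hg.eq_of_liesOn hx (hP μ (hFP hμ)).2,
      Finset.sum_const, hcard] at hle
    exact hN.not_ge hle
  exact ⟨hzero, fun ⟨g, hg, hne⟩ => hne _ h0 (hzero g hg)⟩
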